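/- arXiv:1309.6298 — 2 statements merged into one kernel-verified Lean document; each statement's English description precedes it below -/
import Mathlib

section
/- Let R be an idempotent semiring and let A ∈ M_n(R) be a matrix such that every circuit of A has weight less than or equal to 1, i.e., for every sequence of indices i_0, i_1, …, i_k in [n] with k ≥ 1 and i_k = i_0, the product A_{i_0 i_1}·A_{i_1 i_2}·⋯·A_{i_{k-1} i_k} ≤ 1 in the natural order. Then for every m ≥ n−1 one has I + A + A^2 + ⋯ + A^m = I + A + A^2 + ⋯ + A^{n-1}, where I is the identity matrix; in particular the Kleene star A* := Σ_{i≥0} A^i equals I + A + ⋯ + A^{n-1}. -/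
open Finset

/-- The weight of the walk `p 0, p 1, …, p k` with respect to the matrix `A`. -/
def walkWeight {R ι : Type*} [Semiring R] (A : Matrix ι ι R) (p : ℕ → ι) (k : ℕ) : R :=
  ((List.range k).map fun t => A (p t) (p (t + 1))).prod

section walkWeight

variable {R ι : Type*}

@[simp]
theorem walkWeight_zero [Semiring R] (A : Matrix ι ι R) (p : ℕ → ι) : walkWeight A p 0 = 1 := by
  simp [walkWeight]

theorem walkWeight_succ [Semiring R] (A : Matrix ι ι R) (p : ℕ → ι) (k : ℕ) :
    walkWeight A p (k + 1) = walkWeight A p k * A (p k) (p (k + 1)) := by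
  simp [walkWeight, List.range_succ]

theorem walkWeight_congr [Semiring R] (A : Matrix ι ι R) {p q : ℕ → ι} {k : ℕ}
    (h : ∀ t ≤ k, p t = q t) : walkWeight A p k = walkWeight A q k := by
  induction k with
  | zero => simp
  | succ k ih =>
    rw [walkWeight_succ, walkWeight_succ, ih fun t ht => h t (by lia), h k (by lia),
      h (k + 1) le_rfl]

theorem walkWeight_add [Semiring R] (A : Matrix ι ι R) (p : ℕ → ι) (k l : ℕ) :
    walkWeight A p (k + l) = walkWeight A p k * walkWeight A (fun t => p (k + t)) l := by
  induction l with
  | zero => simp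
  | succ l ih => rw [← add_assoc, walkWeight_succ, ih, walkWeight_succ, mul_assoc, add_assoc]

variable [IdemSemiring R]

theorem sum_le_of_forall_le {α : Type*} {s : Finset α} {f : α → R} {y : R}
    (h : ∀ a ∈ s, f a ≤ y) : ∑ a ∈ s, f a ≤ y :=
  Finset.sum_induction f (· ≤ y) (fun _ _ ha hb => add_le ha hb) (zero_le (a := y)) h

variable [Fintype ι] [DecidableEq ι]

theorem walkWeight_le_pow (A : Matrix ι ι R) (p : ℕ → ι) (k : ℕ) :
    walkWeight A p k ≤ (A ^ k) (p 0) (p k) := by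
  induction k with
  | zero => simp
  | succ k ih =>
    rw [walkWeight_succ, pow_succ, Matrix.mul_apply]
    exact (mul_le_mul_left ih _).trans
      (Finset.single_le_sum_of_canonicallyOrdered (f := fun j => (A ^ k) (p 0) j * A j (p (k + 1)))
        (Finset.mem_univ (p k)))

theorem mul_pow_apply_le (A : Matrix ι ι R) {y : R} {j : ι} (k : ℕ) {i : ι} {c : R}
    (h : ∀ p : ℕ → ι, p 0 = i → p k = j → c * walkWeight A p k ≤ y) :
    c * (A ^ k) i j ≤ y := by
  induction k generalizing i c with
  | zero =>
    by_cases hij : i = j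
    · simpa [hij] using h (fun _ => i) rfl hij
    · simp [Matrix.one_apply_ne hij]
  | succ k ih =>
    rw [pow_succ', Matrix.mul_apply, Finset.mul_sum]
    refine sum_le_of_forall_le fun l _ => ?_
    rw [← mul_assoc]
    refine ih fun p hp0 hpk => ?_
    have hp := h (fun t => Nat.casesOn t i p) rfl hpk
    rw [add_comm k 1, walkWeight_add, ← mul_assoc] at hp
    simpa [walkWeight, add_comm 1, hp0] using hp

/-- If all circuits have weight at most `1`, cutting out circuits bounds the weight of any walk by
the sum of the powers of exponent less than the number of indices. -/
theorem walkWeight_le_sum_pow (A : Matrix ι ι R)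
    (hcirc : ∀ (k : ℕ) (p : ℕ → ι), 0 < k → p k = p 0 → walkWeight A p k ≤ 1)
    (k : ℕ) (p : ℕ → ι) :
    walkWeight A p k ≤ ∑ i ∈ Finset.range (Fintype.card ι), (A ^ i) (p 0) (p k) := by
  induction k using Nat.strong_induction_on generalizing p with
  | _ k ih =>
    rcases lt_or_ge k (Fintype.card ι) with hk | hk
    · exact (walkWeight_le_pow A p k).trans
        (Finset.single_le_sum_of_canonicallyOrdered (f := fun i => (A ^ i) (p 0) (p k))
          (Finset.mem_range.2 hk))
    obtain ⟨s, d, e, hd, rfl, hp⟩ : ∃ s d e, 0 < d ∧ k = s + d + e ∧ p (s + d) = p s := by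
      obtain ⟨a, b, hab, h⟩ := Fintype.exists_ne_map_eq_of_card_lt
        (fun t : Fin (k + 1) => p t) (by simpa using Nat.lt_succ_of_le hk)
      rcases lt_or_gt_of_ne (Fin.val_ne_of_ne hab) with hlt | hlt
      · exact ⟨a, b - a, k - b, by lia, by lia, by rw [Nat.add_sub_of_le hlt.le, ← h]⟩
      · exact ⟨b, a - b, k - a, by lia, by lia, by rw [Nat.add_sub_of_le hlt.le, ← h]⟩
    let q : ℕ → ι := fun t => if t ≤ s then p t else p (t + d)
    have hq (t : ℕ) : q (s + t) = p (s + d + t) := by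
      rcases Nat.eq_zero_or_pos t with rfl | ht
      · simp [q, hp]
      · simp only [q, if_neg (show ¬ s + t ≤ s by lia), add_right_comm s t d]
    have hweight : walkWeight A q (s + e) =
        walkWeight A p s * walkWeight A (fun t => p (s + d + t)) e := by
      rw [walkWeight_add, walkWeight_congr A (q := p) fun t ht => if_pos ht]
      simp only [hq]
    calc walkWeight A p (s + d + e)
        ≤ walkWeight A p s * 1 * walkWeight A (fun t => p (s + d + t)) e := by
          rw [walkWeight_add, walkWeight_add]
          gcongr
          exact hcirc d _ hd hp
      _ = walkWeight A q (s + e) := by rw [mul_one, hweight]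
      _ ≤ _ := by
          have h := ih (s + e) (by lia) q
          rwa [hq, show q 0 = p 0 from if_pos s.zero_le] at h

theorem sum_pow_eq_sum_pow_card (A : Matrix ι ι R)
    (hcirc : ∀ (k : ℕ) (p : ℕ → ι), 0 < k → p k = p 0 → walkWeight A p k ≤ 1)
    {m : ℕ} (hm : Fintype.card ι ≤ m) :
    ∑ i ∈ Finset.range m, A ^ i = ∑ i ∈ Finset.range (Fintype.card ι), A ^ i := by
  ext i j
  simp only [Matrix.sum_apply]
  apply le_antisymm
  · refine sum_le_of_forall_le fun k _ => ?_
    rw [← one_mul ((A ^ k) i j)]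
    refine mul_pow_apply_le A k ?_
    rintro p rfl rfl
    rw [one_mul]
    exact walkWeight_le_sum_pow A hcirc k p
  · exact sum_le_of_forall_le fun k hk =>
      Finset.single_le_sum_of_canonicallyOrdered (f := fun k => (A ^ k) i j)
        (Finset.range_mono hm hk)

end walkWeight

/-- Carré–Gondran theorem: over an idempotent semiring, if every circuit of the matrix
`A` has weight at most `1` in the natural order (`x ≤ y ↔ x + y = y`), then the partial
sums `I + A + ⋯ + A^m` stabilize from `m = n - 1` on; in particular the Kleene star
`A^*` equals `I + A + ⋯ + A^{n-1}`. -/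
theorem stmt6 {R : Type*} [Semiring R] (hidem : ∀ a : R, a + a = a)
    (n : ℕ) (A : Matrix (Fin n) (Fin n) R)
    (hcirc : ∀ (k : ℕ) (p : ℕ → Fin n), 0 < k → p k = p 0 →
      ((List.range k).map fun t => A (p t) (p (t + 1))).prod + 1 = 1) :
    ∀ m : ℕ, n - 1 ≤ m →
      ∑ i ∈ Finset.range (m + 1), A ^ i = ∑ i ∈ Finset.range n, A ^ i := by
  intro m hm
  let : IdemSemiring R := IdemSemiring.ofSemiring hidem
  have h := sum_pow_eq_sum_pow_card (m := m + 1) A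
    (fun k p hk hp => add_eq_right_iff_le.1 (hcirc k p hk hp)) (by simpa using by lia)
  rwa [Fintype.card_fin] at h
end

section
/- For ℓ ∈ [n-1], let the ℓ-th signed tropical hyperplane have parameter vector a^ℓ ∈ ℝ_max^n, not identically −∞, and nontrivial partition [n] = I_ℓ ∪ J_ℓ, with sign s^ℓ_i = +1 if i ∈ I_ℓ and s^ℓ_i = −1 if i ∈ J_ℓ. For k ∈ [n], let M(k) be the (n-1)×(n-1) matrix over ℝ_max with rows indexed by ℓ ∈ [n-1] and columns by [n]∖{k}, entries a^ℓ_i; identify [n]∖{k} with [n-1] by the order-preserving bijection so that permutations of its columns have a well-defined signature. Assume general position: for every k ∈ [n], per M(k) is finite and all permutations σ attaining per M(k) yield the same value of sgn(σ)·Π_{ℓ∈[n-1]} s^ℓ_{σ(ℓ)}. Then there exists a sign pattern ε ∈ {+1,−1}^n, unique up to replacing ε by −ε, such that the transformed hyperplanes H_1(ε),…,H_{n-1}(ε) have a common point x ∈ ℝ_max^n not identically −∞; moreover any two such common points differ by adding a single real constant to every entry. -/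
open Finset

/-- Membership in the sign-transformation, by the sign pattern `ε`, of the `ℓ`-th signed
tropical hyperplane with parameter vector `a ℓ` and signs `s ℓ` (`true` codes `+1`,
i.e. membership in `I_ℓ`, and `false` codes `-1`). -/
def inTransformedHyp {m : ℕ} (a : Fin m → Fin (m + 1) → WithBot ℝ)
    (s : Fin m → Fin (m + 1) → Bool) (ε : Fin (m + 1) → Bool) (ℓ : Fin m)
    (x : Fin (m + 1) → WithBot ℝ) : Prop :=
  ((Finset.univ.filter fun i => s ℓ i = ε i).sup fun i => a ℓ i + x i) =
  ((Finset.univ.filter fun i => s ℓ i ≠ ε i).sup fun i => a ℓ i + x i)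

/-- The tropical permanent of the matrix `M(k)` (rows `ℓ ∈ [m]`, columns `[m+1]∖{k}`
identified with `[m]` via the order-preserving bijection `Fin.succAbove k`). -/
noncomputable def perMk {m : ℕ} (a : Fin m → Fin (m + 1) → WithBot ℝ)
    (k : Fin (m + 1)) : WithBot ℝ :=
  Finset.univ.sup fun σ : Equiv.Perm (Fin m) => ∑ ℓ, a ℓ (k.succAbove (σ ℓ))

/-- The signed value `sgn(σ)·Π_ℓ s^ℓ_{σ(ℓ)}` of a permutation `σ` of the columns of
`M(k)`, as an integer. -/
def signedVal {m : ℕ} (s : Fin m → Fin (m + 1) → Bool) (k : Fin (m + 1))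
    (σ : Equiv.Perm (Fin m)) : ℤ :=
  (Equiv.Perm.sign σ : ℤ) * ∏ ℓ, (if s ℓ (k.succAbove (σ ℓ)) then 1 else -1 : ℤ)

open Filter

/-- The real number `±1` coded by a Boolean. -/
def boolSign (b : Bool) : ℝ := if b then 1 else -1

theorem boolSign_mul_self (b : Bool) : boolSign b * boolSign b = 1 := by
  cases b <;> simp [boolSign]

theorem boolSign_mul_of_eq {b c : Bool} (h : b = c) : boolSign b * boolSign c = 1 := by
  rw [h, boolSign_mul_self]

theorem boolSign_mul_of_ne {b c : Bool} (h : b ≠ c) : boolSign b * boolSign c = -1 := by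
  cases b <;> cases c <;> simp_all [boolSign]

theorem boolSign_mul_eq_one_or (b c : Bool) :
    boolSign b * boolSign c = 1 ∨ boolSign b * boolSign c = -1 := by
  cases b <;> cases c <;> simp [boolSign]

theorem sum_boolSign_mul {ι : Type*} [Fintype ι] (s ε : ι → Bool) (f : ι → ℝ) :
    ∑ i, boolSign (s i) * boolSign (ε i) * f i =
      ∑ i with s i = ε i, f i - ∑ i with s i ≠ ε i, f i := by
  rw [← Finset.sum_filter_add_sum_filter_not Finset.univ (fun i => s i = ε i), sub_eq_add_neg,
    ← Finset.sum_neg_distrib]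
  congr 1 <;> refine Finset.sum_congr rfl fun i hi => ?_
  · rw [boolSign_mul_of_eq (Finset.mem_filter.mp hi).2, one_mul]
  · rw [boolSign_mul_of_ne (Finset.mem_filter.mp hi).2, neg_one_mul]

/-- The function `u ↦ exp (u * w)`, which vanishes for `w = ⊥`. -/
noncomputable def tropExp (w : WithBot ℝ) (u : ℝ) : ℝ :=
  WithBot.recBotCoe 0 (fun r : ℝ => Real.exp (u * r)) w

@[simp] theorem tropExp_bot (u : ℝ) : tropExp ⊥ u = 0 := rfl

@[simp] theorem tropExp_coe (r u : ℝ) : tropExp (r : WithBot ℝ) u = Real.exp (u * r) := rfl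

theorem tropExp_nonneg (w : WithBot ℝ) (u : ℝ) : 0 ≤ tropExp w u := by
  induction w with
  | bot => simp
  | coe r => simpa using (Real.exp_pos _).le

theorem tropExp_pos {w : WithBot ℝ} (hw : w ≠ ⊥) (u : ℝ) : 0 < tropExp w u := by
  induction w with
  | bot => exact absurd rfl hw
  | coe r => simpa using Real.exp_pos _

theorem tropExp_add (w w' : WithBot ℝ) (u : ℝ) :
    tropExp (w + w') u = tropExp w u * tropExp w' u := by
  induction w with
  | bot => simp
  | coe r =>
    induction w' with
    | bot => simp
    | coe r' => simp only [← WithBot.coe_add, tropExp_coe, mul_add, Real.exp_add]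

theorem tropExp_mono {w w' : WithBot ℝ} (h : w ≤ w') {u : ℝ} (hu : 0 ≤ u) :
    tropExp w u ≤ tropExp w' u := by
  induction w with
  | bot => simpa using tropExp_nonneg w' u
  | coe r =>
    induction w' with
    | bot => simp at h
    | coe r' =>
      simpa using mul_le_mul_of_nonneg_left (WithBot.coe_le_coe.mp h) hu

theorem eventually_tropExp_le {w w' : WithBot ℝ} (h : w' < w) {c : ℝ} (hc : 0 < c) :
    ∀ᶠ u in atTop, tropExp w' u ≤ c * tropExp w u := by
  induction w with
  | bot => simp at h
  | coe r =>
    induction w' with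
    | bot => exact .of_forall fun u => by simpa using mul_nonneg hc.le (Real.exp_pos _).le
    | coe r' =>
      have hr : r' < r := WithBot.coe_lt_coe.mp h
      have ht : Tendsto (fun u : ℝ => Real.exp (u * (r' - r))) atTop (nhds 0) :=
        Real.tendsto_exp_atBot.comp (tendsto_id.atTop_mul_const_of_neg (sub_neg.mpr hr))
      filter_upwards [ht.eventually (ge_mem_nhds hc)] with u hu
      have he : Real.exp (u * r') = Real.exp (u * (r' - r)) * Real.exp (u * r) := by
        rw [← Real.exp_add]; ring_nf
      simpa [he] using mul_le_mul_of_nonneg_right hu (Real.exp_pos (u * r)).le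

/-- `f` grows like `u ↦ exp (u * w)` up to positive constants as `u → ∞`. -/
def HasGrowth (f : ℝ → ℝ) (w : WithBot ℝ) : Prop :=
  ∃ c C : ℝ, 0 < c ∧ 0 < C ∧ ∀ᶠ u in atTop, c * tropExp w u ≤ f u ∧ f u ≤ C * tropExp w u

theorem hasGrowth_tropExp (w : WithBot ℝ) : HasGrowth (tropExp w) w :=
  ⟨1, 1, one_pos, one_pos, .of_forall fun u => by simp⟩

theorem hasGrowth_zero : HasGrowth (fun _ => 0) ⊥ :=
  ⟨1, 1, one_pos, one_pos, .of_forall fun u => by simp⟩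

theorem hasGrowth_one : HasGrowth (fun _ => 1) 0 :=
  ⟨1, 1, one_pos, one_pos, .of_forall fun u => by simp [← WithBot.coe_zero]⟩

namespace HasGrowth

variable {f g : ℝ → ℝ} {w w' : WithBot ℝ}

theorem eventually_pos (hf : HasGrowth f w) (hw : w ≠ ⊥) : ∀ᶠ u in atTop, 0 < f u := by
  obtain ⟨c, C, hc, -, h⟩ := hf
  filter_upwards [h] with u hu
  exact (mul_pos hc (tropExp_pos hw u)).trans_le hu.1

theorem mul (hf : HasGrowth f w) (hg : HasGrowth g w') :
    HasGrowth (fun u => f u * g u) (w + w') := by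
  obtain ⟨c, C, hc, hC, h⟩ := hf
  obtain ⟨c', C', hc', hC', h'⟩ := hg
  refine ⟨c * c', C * C', mul_pos hc hc', mul_pos hC hC', ?_⟩
  filter_upwards [h, h'] with u hu hu'
  have e := mul_nonneg hc.le (tropExp_nonneg w u)
  have e' := mul_nonneg hc'.le (tropExp_nonneg w' u)
  rw [tropExp_add, mul_mul_mul_comm, mul_mul_mul_comm C]
  exact ⟨mul_le_mul hu.1 hu'.1 e' (e.trans hu.1),
    mul_le_mul hu.2 hu'.2 (e'.trans hu'.1) ((e.trans hu.1).trans hu.2)⟩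

theorem add (hf : HasGrowth f w) (hg : HasGrowth g w') :
    HasGrowth (fun u => f u + g u) (w ⊔ w') := by
  obtain ⟨c, C, hc, hC, h⟩ := hf
  obtain ⟨c', C', hc', hC', h'⟩ := hg
  refine ⟨min c c', C + C', lt_min hc hc', add_pos hC hC', ?_⟩
  filter_upwards [h, h', eventually_ge_atTop 0] with u hu hu' hu0
  have e := tropExp_nonneg w u
  have e' := tropExp_nonneg w' u
  have m := tropExp_mono (le_sup_left : w ≤ w ⊔ w') hu0
  have m' := tropExp_mono (le_sup_right : w' ≤ w ⊔ w') hu0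
  constructor
  · rcases le_total w w' with hw | hw
    · rw [sup_eq_right.mpr hw]
      nlinarith [min_le_right c c']
    · rw [sup_eq_left.mpr hw]
      nlinarith [min_le_left c c']
  · nlinarith

theorem sub (hf : HasGrowth f w) (hg : HasGrowth g w') (hw : w' < w) :
    HasGrowth (fun u => f u - g u) w := by
  obtain ⟨c, C, hc, hC, h⟩ := hf
  obtain ⟨c', C', hc', hC', h'⟩ := hg
  refine ⟨c / 2, C, half_pos hc, hC, ?_⟩
  filter_upwards [h, h', eventually_tropExp_le hw (c := c / 2 / C') (by positivity)]
    with u hu hu' hu''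
  have e' := mul_nonneg hc'.le (tropExp_nonneg w' u)
  have k : C' * tropExp w' u ≤ c / 2 * tropExp w u := by
    calc _ ≤ C' * (c / 2 / C' * tropExp w u) := mul_le_mul_of_nonneg_left hu'' hC'.le
      _ = _ := by field_simp
  constructor <;> linarith [hu.1, hu.2, hu'.1, hu'.2]

theorem congr (hf : HasGrowth f w) (h : ∀ᶠ u in atTop, f u = g u) : HasGrowth g w := by
  obtain ⟨c, C, hc, hC, h'⟩ := hf
  refine ⟨c, C, hc, hC, ?_⟩
  filter_upwards [h, h'] with u hu hu'
  rwa [← hu]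

theorem unique (hf : HasGrowth f w) (hf' : HasGrowth f w') : w = w' := by
  have key : ∀ {v v' : WithBot ℝ}, HasGrowth f v → HasGrowth f v' → ¬ v' < v := by
    intro v v' h h' hlt
    obtain ⟨u, hu⟩ := ((h.sub h' hlt).eventually_pos (ne_bot_of_gt hlt)).exists
    simp at hu
  exact le_antisymm (not_lt.mp (key hf hf')) (not_lt.mp (key hf' hf))

theorem sum {ι : Type*} (S : Finset ι) {f : ι → ℝ → ℝ} {w : ι → WithBot ℝ}
    (h : ∀ i ∈ S, HasGrowth (f i) (w i)) : HasGrowth (fun u => ∑ i ∈ S, f i u) (S.sup w) := by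
  classical
  induction S using Finset.induction_on with
  | empty => simpa using hasGrowth_zero
  | insert i S hi ih =>
    simp only [Finset.sum_insert hi, Finset.sup_insert]
    exact (h i (by simp)).add (ih fun j hj => h j (by simp [hj]))

theorem prod {ι : Type*} (S : Finset ι) {f : ι → ℝ → ℝ} {w : ι → WithBot ℝ}
    (h : ∀ i ∈ S, HasGrowth (f i) (w i)) :
    HasGrowth (fun u => ∏ i ∈ S, f i u) (∑ i ∈ S, w i) := by
  classical
  induction S using Finset.induction_on with
  | empty => simpa using hasGrowth_one
  | insert i S hi ih =>
    simp only [Finset.prod_insert hi, Finset.sum_insert hi]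
    exact (h i (by simp)).mul (ih fun j hj => h j (by simp [hj]))

end HasGrowth

/-- The `k`-th maximal minor, with its Laplace expansion sign, of an `m × (m + 1)` matrix. -/
noncomputable def signedMinor {m : ℕ} (A : Matrix (Fin m) (Fin (m + 1)) ℝ) (k : Fin (m + 1)) : ℝ :=
  (-1) ^ (k : ℕ) * (A.submatrix id k.succAbove).det

/-- The square matrix obtained by adding a first row `y` to `A`. -/
def consRow {m : ℕ} (y : Fin (m + 1) → ℝ) (A : Matrix (Fin m) (Fin (m + 1)) ℝ) :
    Matrix (Fin (m + 1)) (Fin (m + 1)) ℝ :=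
  Matrix.of fun i j => (Fin.cons (y j) (fun ℓ => A ℓ j) : Fin (m + 1) → ℝ) i

@[simp] theorem consRow_zero {m : ℕ} (y : Fin (m + 1) → ℝ)
    (A : Matrix (Fin m) (Fin (m + 1)) ℝ) (j : Fin (m + 1)) : consRow y A 0 j = y j := rfl

@[simp] theorem consRow_succ {m : ℕ} (y : Fin (m + 1) → ℝ)
    (A : Matrix (Fin m) (Fin (m + 1)) ℝ) (ℓ : Fin m) (j : Fin (m + 1)) :
    consRow y A ℓ.succ j = A ℓ j := rfl

theorem det_consRow_eq_sum_signedMinor {m : ℕ} (A : Matrix (Fin m) (Fin (m + 1)) ℝ)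
    (y : Fin (m + 1) → ℝ) :
    (consRow y A).det =
      ∑ k, y k * signedMinor A k := by
  rw [Matrix.det_succ_row_zero]
  refine Finset.sum_congr rfl fun k _ => ?_
  have : (consRow y A).submatrix Fin.succ k.succAbove = A.submatrix id k.succAbove := rfl
  rw [this, signedMinor, consRow_zero]
  ring

theorem sum_row_mul_signedMinor {m : ℕ} (A : Matrix (Fin m) (Fin (m + 1)) ℝ) (ℓ : Fin m) :
    ∑ k, A ℓ k * signedMinor A k = 0 := by
  rw [← det_consRow_eq_sum_signedMinor]
  refine Matrix.det_zero_of_row_eq (i := 0) (j := ℓ.succ) (Fin.succ_ne_zero ℓ).symm ?_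
  ext j; simp

theorem mul_signedMinor_comm {m : ℕ} (A : Matrix (Fin m) (Fin (m + 1)) ℝ)
    (X : Fin (m + 1) → ℝ) (hX : X ≠ 0) (h : ∀ ℓ, ∑ i, A ℓ i * X i = 0) (j k : Fin (m + 1)) :
    X k * signedMinor A j = X j * signedMinor A k := by
  set y : Fin (m + 1) → ℝ := Pi.single j (X k) - Pi.single k (X j) with hy
  have hdet : (consRow y A).det = 0 := by
    refine Matrix.exists_mulVec_eq_zero_iff.mp ⟨X, hX, ?_⟩
    ext i
    induction i using Fin.cases with
    | zero =>
      simp [Matrix.mulVec, dotProduct, hy, sub_mul, Finset.sum_sub_distrib, Pi.single_apply,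
        mul_comm (X j)]
    | succ ℓ => simpa [Matrix.mulVec, dotProduct] using h ℓ
  rw [det_consRow_eq_sum_signedMinor] at hdet
  simp [hy, sub_mul, Finset.sum_sub_distrib, Pi.single_apply] at hdet
  linarith

theorem signedVal_eq_one_or {m : ℕ} (s : Fin m → Fin (m + 1) → Bool) (k : Fin (m + 1))
    (σ : Equiv.Perm (Fin m)) : signedVal s k σ = 1 ∨ signedVal s k σ = -1 := by
  rw [← Int.isUnit_iff]
  refine (Units.isUnit _).mul (IsUnit.prod_iff.mpr fun ℓ _ => ?_)
  split <;> simp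

theorem signedMinor_eq_sum {m : ℕ} (s : Fin m → Fin (m + 1) → Bool)
    (g : Fin m → Fin (m + 1) → ℝ) (k : Fin (m + 1)) :
    signedMinor (Matrix.of fun ℓ i => boolSign (s ℓ i) * g ℓ i) k =
      (-1) ^ (k : ℕ) * ∑ σ : Equiv.Perm (Fin m),
        (signedVal s k σ : ℝ) * ∏ ℓ, g ℓ (k.succAbove (σ ℓ)) := by
  rw [signedMinor, ← Matrix.det_transpose, Matrix.det_apply']
  congr 1
  refine Finset.sum_congr rfl fun σ _ => ?_
  simp only [Matrix.transpose_apply, Matrix.submatrix_apply, Matrix.of_apply, id,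
    Finset.prod_mul_distrib, signedVal, boolSign]
  push_cast
  ring

theorem hasGrowth_sum_signedVal {m : ℕ} {a : Fin m → Fin (m + 1) → WithBot ℝ}
    {s : Fin m → Fin (m + 1) → Bool} {k : Fin (m + 1)} (hk : perMk a k ≠ ⊥)
    {σ₀ : Equiv.Perm (Fin m)} (hσ₀ : ∑ ℓ, a ℓ (k.succAbove (σ₀ ℓ)) = perMk a k)
    (hgen : ∀ σ : Equiv.Perm (Fin m), ∑ ℓ, a ℓ (k.succAbove (σ ℓ)) = perMk a k →
      signedVal s k σ = signedVal s k σ₀)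
    {g : Fin m → Fin (m + 1) → ℝ → ℝ} (hg : ∀ ℓ i, HasGrowth (g ℓ i) (a ℓ i)) :
    HasGrowth (fun u => (signedVal s k σ₀ : ℝ) * ∑ σ : Equiv.Perm (Fin m),
        (signedVal s k σ : ℝ) * ∏ ℓ, g ℓ (k.succAbove (σ ℓ)) u) (perMk a k) := by
  have hprod (σ : Equiv.Perm (Fin m)) : HasGrowth (fun u => ∏ ℓ, g ℓ (k.succAbove (σ ℓ)) u)
      (∑ ℓ, a ℓ (k.succAbove (σ ℓ))) := HasGrowth.prod _ fun ℓ _ => hg ℓ _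
  have hle (σ : Equiv.Perm (Fin m)) : ∑ ℓ, a ℓ (k.succAbove (σ ℓ)) ≤ perMk a k :=
    Finset.le_sup (f := fun σ : Equiv.Perm (Fin m) => ∑ ℓ, a ℓ (k.succAbove (σ ℓ)))
      (Finset.mem_univ σ)
  have hpos := HasGrowth.sum (Finset.univ.filter fun σ => signedVal s k σ = signedVal s k σ₀)
    fun σ _ => hprod σ
  have hneg := HasGrowth.sum (Finset.univ.filter fun σ => ¬ signedVal s k σ = signedVal s k σ₀)
    fun σ _ => hprod σ
  have hsup : (Finset.univ.filter fun σ => signedVal s k σ = signedVal s k σ₀).sup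
      (fun σ => ∑ ℓ, a ℓ (k.succAbove (σ ℓ))) = perMk a k := by
    refine le_antisymm (Finset.sup_le fun σ _ => hle σ) ?_
    rw [← hσ₀]
    exact Finset.le_sup (f := fun σ : Equiv.Perm (Fin m) => ∑ ℓ, a ℓ (k.succAbove (σ ℓ)))
      (by simp)
  rw [hsup] at hpos
  refine (hpos.sub hneg ?_).congr (.of_forall fun u => ?_)
  · refine (Finset.sup_lt_iff (bot_lt_iff_ne_bot.mpr hk)).mpr fun σ hσ => ?_
    exact (hle σ).lt_of_ne fun h => (Finset.mem_filter.mp hσ).2 (hgen σ h)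
  · rw [Finset.mul_sum, ← Finset.sum_filter_add_sum_filter_not Finset.univ
      (fun σ => signedVal s k σ = signedVal s k σ₀), sub_eq_add_neg, ← Finset.sum_neg_distrib]
    congr 1 <;> refine Finset.sum_congr rfl fun σ hσ => ?_
    · rw [(Finset.mem_filter.mp hσ).2]
      rcases signedVal_eq_one_or s k σ₀ with h | h <;> simp [h]
    · have hne := (Finset.mem_filter.mp hσ).2
      rcases signedVal_eq_one_or s k σ₀ with h | h <;>
        rcases signedVal_eq_one_or s k σ with h' | h' <;> simp_all

theorem exists_hasGrowth_signedMinor {m : ℕ} {a : Fin m → Fin (m + 1) → WithBot ℝ}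
    {s : Fin m → Fin (m + 1) → Bool} {k : Fin (m + 1)} (hk : perMk a k ≠ ⊥)
    (hgen : ∀ σ π : Equiv.Perm (Fin m),
        (∑ ℓ, a ℓ (k.succAbove (σ ℓ))) = perMk a k →
        (∑ ℓ, a ℓ (k.succAbove (π ℓ))) = perMk a k →
        signedVal s k σ = signedVal s k π) :
    ∃ b : Bool, ∀ g : Fin m → Fin (m + 1) → ℝ → ℝ, (∀ ℓ i, HasGrowth (g ℓ i) (a ℓ i)) →
      HasGrowth (fun u => boolSign b *
        signedMinor (Matrix.of fun ℓ i => boolSign (s ℓ i) * g ℓ i u) k) (perMk a k) := by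
  obtain ⟨σ₀, -, hσ₀⟩ := Finset.exists_mem_eq_sup Finset.univ Finset.univ_nonempty
    (fun σ : Equiv.Perm (Fin m) => ∑ ℓ, a ℓ (k.succAbove (σ ℓ)))
  obtain ⟨b, hb⟩ : ∃ b : Bool, boolSign b * (-1) ^ (k : ℕ) = (signedVal s k σ₀ : ℝ) := by
    rcases neg_one_pow_eq_or ℝ (k : ℕ) with h | h <;>
      rcases signedVal_eq_one_or s k σ₀ with h' | h' <;> rw [h, h'] <;> simp [boolSign]
  refine ⟨b, fun g hg => ?_⟩
  simp only [signedMinor_eq_sum, ← mul_assoc, hb]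
  exact hasGrowth_sum_signedVal hk hσ₀.symm (fun σ h => hgen σ σ₀ h hσ₀.symm) hg

theorem inTransformedHyp_of_sum_eq_zero {m : ℕ} {a : Fin m → Fin (m + 1) → WithBot ℝ}
    {s : Fin m → Fin (m + 1) → Bool} {ε : Fin (m + 1) → Bool} {ℓ : Fin m}
    {x : Fin (m + 1) → WithBot ℝ} {f : Fin (m + 1) → ℝ → ℝ}
    (hf : ∀ i, HasGrowth (f i) (a ℓ i + x i))
    (h : ∀ u, ∑ i, boolSign (s ℓ i) * boolSign (ε i) * f i u = 0) :
    inTransformedHyp a s ε ℓ x := by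
  refine (HasGrowth.sum _ fun i _ => hf i).unique
    ((HasGrowth.sum _ fun i _ => hf i).congr (.of_forall fun u => ?_))
  have hu := h u
  rw [sum_boolSign_mul] at hu
  linarith

theorem exists_sum_eq_zero_of_inTransformedHyp {m : ℕ} {a : Fin m → Fin (m + 1) → WithBot ℝ}
    {s : Fin m → Fin (m + 1) → Bool} {ε : Fin (m + 1) → Bool} {ℓ : Fin m}
    {x : Fin (m + 1) → WithBot ℝ} (h : inTransformedHyp a s ε ℓ x) :
    ∃ g : Fin (m + 1) → ℝ → ℝ, (∀ i, HasGrowth (g i) (a ℓ i)) ∧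
      ∀ u, ∑ i, boolSign (s ℓ i) * g i u * (boolSign (ε i) * tropExp (x i) u) = 0 := by
  unfold inTransformedHyp at h
  have hp := HasGrowth.sum (Finset.univ.filter fun i => s ℓ i = ε i)
    fun i _ => hasGrowth_tropExp (a ℓ i + x i)
  have hq := HasGrowth.sum (Finset.univ.filter fun i => s ℓ i ≠ ε i)
    fun i _ => hasGrowth_tropExp (a ℓ i + x i)
  rw [← h] at hq
  set p : ℝ → ℝ := fun u => ∑ i ∈ Finset.univ.filter (fun i => s ℓ i = ε i),
    tropExp (a ℓ i + x i) u
  set q : ℝ → ℝ := fun u => ∑ i ∈ Finset.univ.filter (fun i => s ℓ i ≠ ε i),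
    tropExp (a ℓ i + x i) u
  generalize hT : ((Finset.univ.filter fun i => s ℓ i = ε i).sup fun i => a ℓ i + x i) = T
    at h hp hq
  induction T with
  | bot =>
    refine ⟨fun i => tropExp (a ℓ i), fun i => hasGrowth_tropExp _, fun u => ?_⟩
    refine Finset.sum_eq_zero fun i _ => ?_
    have hi : a ℓ i + x i = ⊥ := by
      by_cases hi : s ℓ i = ε i
      · exact (Finset.sup_eq_bot_iff _ _).mp hT i (by simp [hi])
      · exact (Finset.sup_eq_bot_iff _ _).mp h.symm i (by simp [hi])
    have := tropExp_add (a ℓ i) (x i) u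
    rw [hi, tropExp_bot] at this
    linear_combination -(boolSign (s ℓ i) * boolSign (ε i)) * this
  | coe t =>
    refine ⟨fun i u => tropExp (a ℓ i) u *
      ((if s ℓ i = ε i then q u else p u) * tropExp ((-t : ℝ) : WithBot ℝ) u),
      fun i => ?_, fun u => ?_⟩
    · have hc : HasGrowth (fun u => if s ℓ i = ε i then q u else p u) t := by
        split_ifs <;> assumption
      have := (hasGrowth_tropExp (a ℓ i)).mul
        (hc.mul (hasGrowth_tropExp ((-t : ℝ) : WithBot ℝ)))
      rwa [← WithBot.coe_add, add_neg_cancel, WithBot.coe_zero, add_zero] at this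
    · have hterm : ∀ i, boolSign (s ℓ i) * (tropExp (a ℓ i) u *
          ((if s ℓ i = ε i then q u else p u) * tropExp ((-t : ℝ) : WithBot ℝ) u)) *
          (boolSign (ε i) * tropExp (x i) u) =
          (boolSign (s ℓ i) * boolSign (ε i) * ((if s ℓ i = ε i then q u else p u) *
            tropExp (a ℓ i + x i) u)) * tropExp ((-t : ℝ) : WithBot ℝ) u := fun i => by
        rw [tropExp_add]; ring
      simp only [hterm]
      rw [← Finset.sum_mul, sum_boolSign_mul,
        Finset.sum_congr rfl (g := fun i => q u * tropExp (a ℓ i + x i) u) (fun i hi => by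
          rw [if_pos (Finset.mem_filter.mp hi).2]),
        Finset.sum_congr rfl (s₁ := Finset.univ.filter fun i => s ℓ i ≠ ε i)
          (g := fun i => p u * tropExp (a ℓ i + x i) u) (fun i hi => by
          rw [if_neg (Finset.mem_filter.mp hi).2]),
        ← Finset.mul_sum, ← Finset.mul_sum]
      exact mul_eq_zero_of_left (sub_eq_zero.mpr (mul_comm (q u) (p u))) _

/-- Tropical Cramer rule: a common point is proportional to the vector of tropical maximal
minors, and its sign pattern is proportional to the signs of these minors. -/
theorem cramer_of_inTransformedHyp {m : ℕ} {a : Fin m → Fin (m + 1) → WithBot ℝ}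
    {s : Fin m → Fin (m + 1) → Bool} {δ : Fin (m + 1) → Bool}
    (hP : ∀ k, perMk a k ≠ ⊥)
    (hδ : ∀ k, ∀ g : Fin m → Fin (m + 1) → ℝ → ℝ, (∀ ℓ i, HasGrowth (g ℓ i) (a ℓ i)) →
      HasGrowth (fun u => boolSign (δ k) *
        signedMinor (Matrix.of fun ℓ i => boolSign (s ℓ i) * g ℓ i u) k) (perMk a k))
    {ε : Fin (m + 1) → Bool} {x : Fin (m + 1) → WithBot ℝ} (hx : ∃ i, x i ≠ ⊥)
    (h : ∀ ℓ, inTransformedHyp a s ε ℓ x) :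
    (ε = δ ∨ ε = fun i => !(δ i)) ∧ ∃ t : ℝ, ∀ i, x i = t + perMk a i := by
  choose g hg hsum using fun ℓ => exists_sum_eq_zero_of_inTransformedHyp (h ℓ)
  obtain ⟨j, hj⟩ := hx
  set F : Fin (m + 1) → ℝ → ℝ := fun k u => boolSign (δ k) *
    signedMinor (Matrix.of fun ℓ i => boolSign (s ℓ i) * g ℓ i u) k with hF
  have hgr (k) : HasGrowth (F k) (perMk a k) := hδ k g hg
  have hcomm (k : Fin (m + 1)) (u : ℝ) :
      tropExp (x k) u * F j u =
        (boolSign (ε k) * boolSign (δ k)) * (boolSign (ε j) * boolSign (δ j)) *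
          (tropExp (x j) u * F k u) := by
    have := mul_signedMinor_comm (Matrix.of fun ℓ i => boolSign (s ℓ i) * g ℓ i u)
      (fun i => boolSign (ε i) * tropExp (x i) u)
      (fun h0 => by
        have h0 := congrFun h0 j
        have hb := boolSign_mul_self (ε j)
        have ht := (tropExp_pos hj u).ne'
        simp only [Pi.zero_apply, mul_eq_zero, ht, or_false] at h0
        simp [h0] at hb)
      (fun ℓ => by simpa using hsum ℓ u) j k
    simp only [hF]
    linear_combination (boolSign (ε k) * boolSign (δ j)) * this
      - tropExp (x k) u * boolSign (δ j) *
        signedMinor (Matrix.of fun ℓ i => boolSign (s ℓ i) * g ℓ i u) j *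
        boolSign_mul_self (ε k)
      - boolSign (ε k) * boolSign (ε j) * boolSign (δ j) * tropExp (x j) u *
        signedMinor (Matrix.of fun ℓ i => boolSign (s ℓ i) * g ℓ i u) k *
        boolSign_mul_self (δ k)
  have hL (k) : HasGrowth (fun u => tropExp (x k) u * F j u) (x k + perMk a j) :=
    (hasGrowth_tropExp _).mul (hgr j)
  have hR (k) : HasGrowth (fun u => tropExp (x j) u * F k u) (x j + perMk a k) :=
    (hasGrowth_tropExp _).mul (hgr k)
  have hsign (k) : (boolSign (ε k) * boolSign (δ k)) * (boolSign (ε j) * boolSign (δ j)) = 1 := by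
    by_contra hne
    have hm : (boolSign (ε k) * boolSign (δ k)) * (boolSign (ε j) * boolSign (δ j)) = -1 := by
      rcases boolSign_mul_eq_one_or (ε k) (δ k) with h1 | h1 <;>
        rcases boolSign_mul_eq_one_or (ε j) (δ j) with h2 | h2 <;> simp_all
    have hpos := (hR k).eventually_pos (by simp [WithBot.add_eq_bot, hj, hP k])
    obtain ⟨u, hu, hFj⟩ := (hpos.and ((hgr j).eventually_pos (hP j))).exists
    have := hcomm k u
    rw [hm] at this
    nlinarith [mul_nonneg (tropExp_nonneg (x k) u) (le_of_lt hFj)]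
  have heq (k) : x k + perMk a j = x j + perMk a k :=
    (hL k).unique ((hR k).congr (.of_forall fun u => by rw [hcomm, hsign, one_mul]))
  constructor
  · by_cases hj' : ε j = δ j
    · left
      funext k
      by_contra hk
      have := hsign k
      rw [boolSign_mul_of_eq hj', boolSign_mul_of_ne hk] at this
      norm_num at this
    · right
      funext k
      by_contra hk
      have := hsign k
      rw [boolSign_mul_of_ne hj', boolSign_mul_of_eq (by simpa using hk)] at this
      norm_num at this
  · obtain ⟨r, hr⟩ := WithBot.ne_bot_iff_exists.mp hj
    obtain ⟨p, hp⟩ := WithBot.ne_bot_iff_exists.mp (hP j)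
    refine ⟨r - p, fun k => ?_⟩
    have hk := heq k
    obtain ⟨pk, hpk⟩ := WithBot.ne_bot_iff_exists.mp (hP k)
    rw [← hr, ← hp, ← hpk] at hk
    rw [← hpk]
    generalize x k = y at hk
    induction y with
    | bot => exact absurd hk (by simp [← WithBot.coe_add])
    | coe y =>
      norm_cast at hk ⊢
      linarith

/-- Given `m` signed tropical hyperplanes in `ℝ_max^{m+1}` in general position, there is
a sign pattern `ε`, unique up to global negation, such that the transformed hyperplanes
have a common point not identically `-∞`; moreover any two such common points differ by
adding a single real constant to every entry. -/
theorem stmt19 (m : ℕ) (a : Fin m → Fin (m + 1) → WithBot ℝ)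
    (s : Fin m → Fin (m + 1) → Bool)
    (ha : ∀ ℓ, ∃ i, a ℓ i ≠ ⊥)
    (hs : ∀ ℓ, (∃ i, s ℓ i = true) ∧ (∃ i, s ℓ i = false))
    (hgen : ∀ k : Fin (m + 1), perMk a k ≠ ⊥ ∧
      ∀ σ π : Equiv.Perm (Fin m),
        (∑ ℓ, a ℓ (k.succAbove (σ ℓ))) = perMk a k →
        (∑ ℓ, a ℓ (k.succAbove (π ℓ))) = perMk a k →
        signedVal s k σ = signedVal s k π) :
    ∃ ε : Fin (m + 1) → Bool,
      (∃ x : Fin (m + 1) → WithBot ℝ, (∃ i, x i ≠ ⊥) ∧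
        ∀ ℓ, inTransformedHyp a s ε ℓ x) ∧
      (∀ ε' : Fin (m + 1) → Bool,
        (∃ x : Fin (m + 1) → WithBot ℝ, (∃ i, x i ≠ ⊥) ∧
          ∀ ℓ, inTransformedHyp a s ε' ℓ x) →
        ε' = ε ∨ ε' = fun i => !(ε i)) ∧
      ∀ x y : Fin (m + 1) → WithBot ℝ,
        (∃ i, x i ≠ ⊥) → (∀ ℓ, inTransformedHyp a s ε ℓ x) →
        (∃ i, y i ≠ ⊥) → (∀ ℓ, inTransformedHyp a s ε ℓ y) →
        ∃ t : ℝ, ∀ i, y i = (t : WithBot ℝ) + x i := by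
  choose δ hδ using fun k => exists_hasGrowth_signedMinor (hgen k).1 (hgen k).2
  have hP (k) : perMk a k ≠ ⊥ := (hgen k).1
  refine ⟨δ, ⟨perMk a, ⟨0, hP 0⟩, fun ℓ => ?_⟩, ?_, ?_⟩
  · have hg : ∀ ℓ i, HasGrowth (tropExp (a ℓ i)) (a ℓ i) := fun ℓ i => hasGrowth_tropExp _
    refine inTransformedHyp_of_sum_eq_zero
      (fun i => (hg ℓ i).mul (hδ i (fun ℓ i => tropExp (a ℓ i)) hg)) fun u => ?_
    rw [← sum_row_mul_signedMinor
      (Matrix.of fun ℓ i => boolSign (s ℓ i) * tropExp (a ℓ i) u) ℓ]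
    refine Finset.sum_congr rfl fun i _ => ?_
    rw [Matrix.of_apply]
    linear_combination (boolSign (s ℓ i) * tropExp (a ℓ i) u *
      signedMinor (Matrix.of fun ℓ i => boolSign (s ℓ i) * tropExp (a ℓ i) u) i) *
      boolSign_mul_self (δ i)
  · rintro ε ⟨x, hx, hxε⟩
    exact (cramer_of_inTransformedHyp hP hδ hx hxε).1
  · intro x y hx hxδ hy hyδ
    obtain ⟨t, ht⟩ := (cramer_of_inTransformedHyp hP hδ hx hxδ).2
    obtain ⟨t', ht'⟩ := (cramer_of_inTransformedHyp hP hδ hy hyδ).2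
    refine ⟨t' - t, fun i => ?_⟩
    rw [ht, ht', ← add_assoc, ← WithBot.coe_add, sub_add_cancel]
end
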